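/- Let X ∈ ℝ^{n×p}, y ∈ {0,1}ⁿ, λ > 0, and suppose (β⋆, S⋆) ∈ ℝᵖ × ℝⁿ is a fixed point of the AMP iteration, i.e. it satisfies (componentwise in i = 1,…,n): X'(y − ρ'(prox_{λρ}(λy + S⋆))) = 0 and λy_i + S⋆_i − λρ'(prox_{λρ}(λy_i + S⋆_i)) = (Xβ⋆)_i. Then Xβ⋆ = prox_{λρ}(λy + S⋆) componentwise, and consequently X'(y − ρ'(Xβ⋆)) = 0; that is, β⋆ satisfies the optimality condition ∇ℓ(β⋆) = 0 for the logistic negative log-likelihood ℓ(b) = Σ_{i=1}^n {ρ(X_i'b) − y_i X_i'b}. -/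

import Mathlib

open MeasureTheory ProbabilityTheory Filter
open scoped Topology NNReal ENNReal

noncomputable section

/-- `ρ(t) = log(1 + eᵗ)`. -/
def rho (t : ℝ) : ℝ := Real.log (1 + Real.exp t)

/-- The sigmoid `ρ'(t) = eᵗ/(1+eᵗ)`. -/
def rho' (t : ℝ) : ℝ := Real.exp t / (1 + Real.exp t)

/-- `ρ''(t) = ρ'(t)(1 - ρ'(t))`. -/
def rho'' (t : ℝ) : ℝ := rho' t * (1 - rho' t)

/-- The proximal operator `prox_{λρ}(z)`, characterized by `t + λρ'(t) = z`. -/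
def prox (lam z : ℝ) : ℝ := Function.invFun (fun t : ℝ => t + lam * rho' t) z

/-- Standard Gaussian measure on `ℝ`. -/
def gauss : Measure ℝ := gaussianReal 0 1

/-- Uniform measure on `[0,1]`. -/
def unif : Measure ℝ := volume.restrict (Set.Icc (0 : ℝ) 1)

/-- `g_MLE⁻¹(γ) = min_t E[(Z - tV)₊²]`, where `Z` is standard normal and `V` is an
independent variable with density `2ρ'(γ·)φ(·)`. -/
def gMLEinv (γ : ℝ) : ℝ :=
  ⨅ t : ℝ, ∫ z, (∫ v, (max (z - t * v) 0) ^ 2 * (2 * rho' (γ * v)) ∂gauss) ∂gauss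

/-- Negative log-likelihood of the logistic model. -/
def negLogLik {n p : ℕ} (X : Fin n → Fin p → ℝ) (y : Fin n → ℝ) (b : Fin p → ℝ) : ℝ :=
  ∑ i, (rho (∑ j, X i j * b j) - y i * ∑ j, X i j * b j)

/-- Logistic responses: `y_i = 1(U_i ≤ ρ'(X_i'β))`, so that `P(y_i = 1 | X_i) = ρ'(X_i'β)`. -/
def resp {n p : ℕ} (X : Fin n → Fin p → ℝ) (U : Fin n → ℝ) (β : Fin p → ℝ) : Fin n → ℝ :=
  fun i => if U i ≤ rho' (∑ j, X i j * β j) then 1 else 0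

/-- Joint law of the design matrix (i.i.d. `N(0, n⁻¹ I_p)` rows) and of independent
uniform variables used to generate logistic responses. -/
def designLaw (n p : ℕ) : Measure ((Fin n → Fin p → ℝ) × (Fin n → ℝ)) :=
  (Measure.pi fun _ : Fin n => Measure.pi fun _ : Fin p => gaussianReal 0 ((n : ℝ≥0))⁻¹).prod
    (Measure.pi fun _ : Fin n => unif)

/-- Iterated expectation over two independent standard Gaussians. -/
def E2 (f : ℝ → ℝ → ℝ) : ℝ := ∫ z1, (∫ z2, f z1 z2 ∂gauss) ∂gauss

/-- The system (S) of three nonlinear equations in `(α, σ, λ)`, with parameters `(κ, γ)`.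
Here `(Q₁, Q₂) = (γ Z₁, -αγ Z₁ + √κ σ Z₂)` is the centered bivariate Gaussian with
`Var(Q₁) = γ²`, `Cov(Q₁, Q₂) = -αγ²`, `Var(Q₂) = α²γ² + κσ²`. -/
def solvesS (κ γ α σ lam : ℝ) : Prop :=
  σ ^ 2 = (1 / κ ^ 2) *
      E2 (fun z1 z2 => 2 * rho' (γ * z1) *
        (lam * rho' (prox lam (-(α * γ) * z1 + Real.sqrt κ * σ * z2))) ^ 2) ∧
  0 = E2 (fun z1 z2 => rho' (γ * z1) * (γ * z1) *
        (lam * rho' (prox lam (-(α * γ) * z1 + Real.sqrt κ * σ * z2)))) ∧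
  1 - κ = E2 (fun z1 z2 => 2 * rho' (γ * z1) /
        (1 + lam * rho'' (prox lam (-(α * γ) * z1 + Real.sqrt κ * σ * z2))))

theorem rho'_mem_Icc (t : ℝ) : rho' t ∈ Set.Icc (0 : ℝ) 1 := by
  have ht := Real.exp_pos t
  refine ⟨by unfold rho'; positivity, ?_⟩
  unfold rho'
  rw [div_le_one (by positivity)]
  linarith

theorem continuous_rho' : Continuous rho' := by
  unfold rho'
  exact Real.continuous_exp.div (by fun_prop) fun t => by positivity

theorem surjective_add_mul_rho' {lam : ℝ} (hlam : 0 ≤ lam) :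
    Function.Surjective fun t : ℝ => t + lam * rho' t := by
  have hcont : Continuous fun t : ℝ => t + lam * rho' t :=
    continuous_id.add (continuous_const.mul continuous_rho')
  refine hcont.surjective ?_ ?_
  · refine tendsto_atTop_mono (fun t => ?_) tendsto_id
    simpa using mul_nonneg hlam (rho'_mem_Icc t).1
  · refine tendsto_atBot_mono (fun t => ?_) (tendsto_atBot_add_const_right _ lam tendsto_id)
    simpa using mul_le_of_le_one_right hlam (rho'_mem_Icc t).2

/-- The proximal fixed-point identity `prox_{λρ}(z) + λρ'(prox_{λρ}(z)) = z`. -/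
theorem prox_add_mul_rho'_prox {lam : ℝ} (hlam : 0 ≤ lam) (z : ℝ) :
    prox lam z + lam * rho' (prox lam z) = z :=
  Function.invFun_eq (surjective_add_mul_rho' hlam z)

/-- A fixed point `(β⋆, S⋆)` of the AMP iteration satisfies the MLE
optimality condition: if `X'(y - ρ'(prox_{λρ}(λy + S⋆))) = 0` and componentwise
`λy_i + S⋆_i - λρ'(prox_{λρ}(λy_i + S⋆_i)) = (Xβ⋆)_i`, then `Xβ⋆ = prox_{λρ}(λy + S⋆)`
componentwise and `X'(y - ρ'(Xβ⋆)) = 0`, i.e. `∇ℓ(β⋆) = 0`. -/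
theorem amp_fixed_point_is_mle_stationary (n p : ℕ)
    (X : Fin n → Fin p → ℝ) (y : Fin n → ℝ) (hy : ∀ i, y i = 0 ∨ y i = 1)
    (lam : ℝ) (hlam : 0 < lam) (βs : Fin p → ℝ) (Ss : Fin n → ℝ)
    (h1 : ∀ j, ∑ i, X i j * (y i - rho' (prox lam (lam * y i + Ss i))) = 0)
    (h2 : ∀ i, lam * y i + Ss i - lam * rho' (prox lam (lam * y i + Ss i)) =
      ∑ j, X i j * βs j) :
    (∀ i, ∑ j, X i j * βs j = prox lam (lam * y i + Ss i)) ∧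
    (∀ j, ∑ i, X i j * (y i - rho' (∑ j', X i j' * βs j')) = 0) := by
  have hprox : ∀ i, ∑ j, X i j * βs j = prox lam (lam * y i + Ss i) := fun i => by
    linarith [h2 i, prox_add_mul_rho'_prox hlam.le (lam * y i + Ss i)]
  refine ⟨hprox, fun j => ?_⟩
  simpa only [hprox] using h1 j
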